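/- For every alternating trilinear form T on ℝ^n and all u, v, w ∈ ℝ^n, writing N = ∑_{1≤l<s<t≤n} T(e_l,e_s,e_t) c(e_l) c(e_s) c(e_t), one has both ∫_{S^{n−1}} Tr( ∑_{i=1}^n ξ_i · c(u) ĉ(v) ĉ(w) N c(e_i) c(ξ) ) dσ(ξ) = 0 and ∫_{S^{n−1}} Tr( ∑_{i=1}^n ξ_i · c(u) ĉ(v) ĉ(w) c(e_i) N c(ξ) ) dσ(ξ) = 0. -/

import Mathlib

open MeasureTheory

noncomputable section

/-- Euclidean space `ℝ^n` with its standard inner product. -/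
abbrev Eucl (n : ℕ) := EuclideanSpace ℝ (Fin n)

/-- The exterior algebra `Λℝ^n`. -/
abbrev ExtAlg (n : ℕ) := ExteriorAlgebra ℝ (Eucl n)

/-- The standard orthonormal basis vector `e_i` of `ℝ^n`. -/
def e (n : ℕ) (i : Fin n) : Eucl n := EuclideanSpace.single i 1

/-- Left exterior multiplication `ε(x)` on `Λℝ^n`. -/
def eps {n : ℕ} (x : Eucl n) : Module.End ℝ (ExtAlg n) :=
  LinearMap.mulLeft ℝ (ExteriorAlgebra.ι ℝ x)

/-- Interior multiplication (contraction) `ι(x)` on `Λℝ^n`, determined by the inner product. -/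
def iot {n : ℕ} (x : Eucl n) : Module.End ℝ (ExtAlg n) :=
  CliffordAlgebra.contractLeft (Q := (0 : QuadraticForm ℝ (Eucl n))) (innerSL ℝ x).toLinearMap

/-- The Clifford action `c(x) = ε(x) − ι(x)`. -/
def c {n : ℕ} (x : Eucl n) : Module.End ℝ (ExtAlg n) := eps x - iot x

/-- The Clifford action `ĉ(x) = ε(x) + ι(x)`. -/
def hc {n : ℕ} (x : Eucl n) : Module.End ℝ (ExtAlg n) := eps x + iot x

/-- The trace of a linear endomorphism of `Λℝ^n`. -/
def Tr {n : ℕ} : Module.End ℝ (ExtAlg n) →ₗ[ℝ] ℝ := LinearMap.trace ℝ (ExtAlg n)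

/-- The surface measure `σ` on the unit sphere `S^{n-1} ⊆ ℝ^n`. -/
def sphMeasure (n : ℕ) : Measure (Metric.sphere (0 : Eucl n) 1) :=
  (volume : Measure (Eucl n)).toSphere

/-- The total surface measure `vol(S^{n-1})` of the unit sphere. -/
def volSph (n : ℕ) : ℝ := (sphMeasure n Set.univ).toReal

section Ring

variable {R : Type*} [Ring R]

theorem commute_mul_of_anticommute {x a b : R} (ha : x * a = -(a * x)) (hb : x * b = -(b * x)) :
    Commute x (a * b) := by
  rw [Commute, SemiconjBy, ← mul_assoc, ha, neg_mul, mul_assoc, hb, mul_neg, neg_neg, mul_assoc]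

theorem anticommute_mul {x a b : R} (ha : x * a = -(a * x)) (hb : Commute x b) :
    x * (a * b) = -(a * b * x) := by
  rw [← mul_assoc, ha, neg_mul, mul_assoc, hb.eq, mul_assoc]

theorem anticommute_mul_of_commute {x a b : R} (ha : Commute x a) (hb : x * b = -(b * x)) :
    x * (a * b) = -(a * b * x) := by
  rw [← mul_assoc, ha.eq, mul_assoc, hb, mul_neg, mul_assoc]

/-- If `x` squares to `-1`, commutes with `a` and anticommutes with `p`, then every tracial
functional vanishes on `a * p`. -/
theorem tracial_mul_eq_zero (f : R →+ ℝ) (hf : ∀ a b, f (a * b) = f (b * a)) {x a p : R}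
    (hx : x * x = -1) (ha : Commute x a) (hp : x * p = -(p * x)) : f (a * p) = 0 := by
  have h : f (a * p * x * x) = -f (a * p * x * x) :=
    calc f (a * p * x * x) = f (x * (a * p * x)) := hf _ _
      _ = f (a * (x * p) * x) := by simp only [← mul_assoc, ha.eq]
      _ = -f (a * p * x * x) := by
        rw [hp, mul_neg, neg_mul, map_neg]; simp only [mul_assoc]
  rw [mul_assoc _ x, hx, mul_neg_one, map_neg] at h
  linarith

theorem sum_smul_mul_mul [Algebra ℝ R] {ι : Type*} [Fintype ι] (r : ι → ℝ) (x : ι → R) (a b : R) :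
    ∑ i, r i • (a * x i * b) = a * (∑ i, r i • x i) * b := by
  simp only [Finset.mul_sum, Finset.sum_mul, mul_smul_comm, smul_mul_assoc]

end Ring

theorem eps_mul_eps_add_swap {n : ℕ} (x y : Eucl n) : eps x * eps y + eps y * eps x = 0 := by
  ext a
  simp [eps, ← mul_assoc, ← add_mul]

theorem iot_mul_iot_add_swap {n : ℕ} (x y : Eucl n) : iot x * iot y + iot y * iot x = 0 := by
  refine LinearMap.ext fun a => ?_
  simp only [iot, LinearMap.add_apply, Module.End.mul_apply, LinearMap.zero_apply]
  rw [CliffordAlgebra.contractLeft_comm, neg_add_cancel]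

theorem iot_mul_eps_add_swap {n : ℕ} (x y : Eucl n) :
    iot x * eps y + eps y * iot x = inner ℝ x y • 1 := by
  refine LinearMap.ext fun a => ?_
  simp only [iot, eps, LinearMap.add_apply, Module.End.mul_apply, LinearMap.mulLeft_apply,
    LinearMap.smul_apply, Module.End.one_apply]
  rw [ExteriorAlgebra.ι, CliffordAlgebra.contractLeft_ι_mul, sub_add_cancel]
  rfl

/-- The Clifford relation for `c`. -/
theorem c_mul_c_add_swap {n : ℕ} (x y : Eucl n) :
    c x * c y + c y * c x = -(2 * inner ℝ x y : ℝ) • 1 := by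
  have h : c x * c y + c y * c x = (eps x * eps y + eps y * eps x)
      + (iot x * iot y + iot y * iot x) - (iot x * eps y + eps y * iot x)
      - (iot y * eps x + eps x * iot y) := by
    simp only [c, mul_sub, sub_mul]; abel
  rw [h, eps_mul_eps_add_swap, iot_mul_iot_add_swap, iot_mul_eps_add_swap,
    iot_mul_eps_add_swap, real_inner_comm x y]
  module

/-- The two Clifford actions anticommute. -/
theorem c_mul_hc {n : ℕ} (x y : Eucl n) : c x * hc y = -(hc y * c x) := by
  have h : c x * hc y + hc y * c x = (eps x * eps y + eps y * eps x)
      - (iot x * iot y + iot y * iot x) - (iot x * eps y + eps y * iot x)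
      + (iot y * eps x + eps x * iot y) := by
    simp only [c, hc, mul_sub, sub_mul, mul_add, add_mul]; abel
  rw [eq_neg_iff_add_eq_zero, h, eps_mul_eps_add_swap, iot_mul_iot_add_swap,
    iot_mul_eps_add_swap, iot_mul_eps_add_swap, real_inner_comm x y]
  module

theorem c_mul_c_self {n : ℕ} (x : Eucl n) : c x * c x = -(inner ℝ x x : ℝ) • 1 := by
  have h : (2 : ℝ) • (c x * c x) = (2 : ℝ) • (-(inner ℝ x x : ℝ) • 1) := by
    rw [two_smul, c_mul_c_add_swap]
    module
  exact smul_right_injective _ two_ne_zero h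

theorem c_mul_c_of_inner_eq_zero {n : ℕ} {x y : Eucl n} (h : inner ℝ x y = 0) :
    c x * c y = -(c y * c x) := by
  rw [eq_neg_iff_add_eq_zero, c_mul_c_add_swap, h]
  simp

theorem commute_c_hc_mul_hc {n : ℕ} (x v w : Eucl n) : Commute (c x) (hc v * hc w) :=
  commute_mul_of_anticommute (c_mul_hc x v) (c_mul_hc x w)

theorem c_add {n : ℕ} (x y : Eucl n) : c (x + y) = c x + c y := by
  refine LinearMap.ext fun a => ?_
  simp [c, eps, iot, add_mul]
  abel

theorem c_smul {n : ℕ} (r : ℝ) (x : Eucl n) : c (r • x) = r • c x := by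
  refine LinearMap.ext fun a => ?_
  simp [c, eps, iot, smul_sub]

/-- The Clifford action `c` as a linear map. -/
def cLinear (n : ℕ) : Eucl n →ₗ[ℝ] Module.End ℝ (ExtAlg n) where
  toFun := c
  map_add' := c_add
  map_smul' := c_smul

theorem sum_smul_e {n : ℕ} (x : Eucl n) : ∑ i, x i • e n i = x := by
  simpa [e] using (EuclideanSpace.basisFun (Fin n) ℝ).sum_repr x

theorem sum_smul_c_e {n : ℕ} (x : Eucl n) : ∑ i, x i • c (e n i) = c x := by
  change ∑ i, x i • cLinear n (e n i) = cLinear n x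
  simp only [← map_smul, ← map_sum, sum_smul_e]

theorem inner_e_of_ne {n : ℕ} {i j : Fin n} (h : i ≠ j) : inner ℝ (e n i) (e n j) = 0 := by
  simp [e, EuclideanSpace.inner_single_left, h]

theorem inner_e_self {n : ℕ} (i : Fin n) : inner ℝ (e n i) (e n i) = (1 : ℝ) := by
  simp [e]

theorem Tr_mul_comm {n : ℕ} (A B : Module.End ℝ (ExtAlg n)) : Tr (A * B) = Tr (B * A) :=
  LinearMap.trace_mul_comm ℝ A B

theorem Tr_hc_mul_hc_mul_c_e {n : ℕ} (v w : Eucl n) {i l s t : Fin n} (hls : l ≠ s)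
    (hlt : l ≠ t) (hst : s ≠ t) :
    Tr (hc v * hc w * (c (e n i) * (c (e n l) * c (e n s) * c (e n t)))) = 0 := by
  have anti {j k : Fin n} (h : j ≠ k) : c (e n j) * c (e n k) = -(c (e n k) * c (e n j)) :=
    c_mul_c_of_inner_eq_zero (inner_e_of_ne h)
  have sq (j : Fin n) : c (e n j) * c (e n j) = -1 := by
    rw [c_mul_c_self, inner_e_self]
    module
  have vanish {j : Fin n} {P : Module.End ℝ (ExtAlg n)} (hP : c (e n j) * P = -(P * c (e n j))) :
      Tr (hc v * hc w * P) = 0 :=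
    tracial_mul_eq_zero Tr.toAddMonoidHom Tr_mul_comm (sq j) (commute_c_hc_mul_hc _ v w) hP
  by_cases hil : l = i
  · refine vanish (j := s) (anticommute_mul (anti (hil ▸ hls.symm)) ?_)
    rw [mul_assoc]
    exact commute_mul_of_anticommute (anti hls.symm)
      (anticommute_mul_of_commute (Commute.refl _) (anti hst))
  · refine vanish (j := l) (anticommute_mul (anti hil) ?_)
    rw [mul_assoc]
    exact (Commute.refl _).mul_right (commute_mul_of_anticommute (anti hls) (anti hlt))

/-- The trace of `ĉ(v) ĉ(w) c(x)` against a Clifford cubic form vanishes. -/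
theorem Tr_hc_mul_hc_mul_c_mul_cubic {n : ℕ} (a : Fin n → Fin n → Fin n → ℝ) (x v w : Eucl n) :
    Tr (hc v * hc w * (c x * ∑ l : Fin n, ∑ s : Fin n, ∑ t : Fin n,
      if l < s ∧ s < t then a l s t • (c (e n l) * c (e n s) * c (e n t)) else 0)) = 0 := by
  rw [← sum_smul_c_e x]
  simp only [Finset.sum_mul, Finset.mul_sum, map_sum]
  refine Finset.sum_eq_zero fun l _ => Finset.sum_eq_zero fun s _ =>
    Finset.sum_eq_zero fun t _ => Finset.sum_eq_zero fun i _ => ?_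
  split_ifs with h
  · simp only [smul_mul_assoc, mul_smul_comm, map_smul]
    rw [Tr_hc_mul_hc_mul_c_e v w h.1.ne (h.1.trans h.2).ne h.2.ne, smul_zero, smul_zero]
  · simp

theorem c_mul_c_mul_c {n : ℕ} (x u : Eucl n) :
    c x * c u * c x = c ((inner ℝ x x : ℝ) • u - (2 * inner ℝ x u : ℝ) • x) := by
  have h := c_mul_c_add_swap x u
  rw [← eq_sub_iff_add_eq] at h
  rw [h, sub_mul, mul_assoc, c_mul_c_self, sub_eq_add_neg (_ • u), ← neg_smul, c_add, c_smul,
    c_smul, smul_mul_assoc, one_mul, mul_smul_comm, mul_one]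
  module

theorem stmt_11 (n : ℕ) (hn : 0 < n) (T : Eucl n [⋀^Fin 3]→ₗ[ℝ] ℝ) (u v w : Eucl n)
    (N : Module.End ℝ (ExtAlg n))
    (hN : N = ∑ l : Fin n, ∑ s : Fin n, ∑ t : Fin n,
        if l < s ∧ s < t then
          T ![e n l, e n s, e n t] • (c (e n l) * c (e n s) * c (e n t)) else 0) :
    ((∫ ξ : Metric.sphere (0 : Eucl n) 1,
        Tr (∑ i : Fin n, (ξ : Eucl n) i •
          (c u * hc v * hc w * N * c (e n i) * ∑ j : Fin n, (ξ : Eucl n) j • c (e n j)))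
        ∂sphMeasure n) = 0) ∧
    ((∫ ξ : Metric.sphere (0 : Eucl n) 1,
        Tr (∑ i : Fin n, (ξ : Eucl n) i •
          (c u * hc v * hc w * c (e n i) * N * ∑ j : Fin n, (ξ : Eucl n) j • c (e n j)))
        ∂sphMeasure n) = 0) := by
  have key : ∀ x, Tr (hc v * hc w * (c x * N)) = 0 := fun x => by
    rw [hN]
    exact Tr_hc_mul_hc_mul_c_mul_cubic (fun l s t => T ![e n l, e n s, e n t]) x v w
  constructor
  · refine integral_eq_zero_of_ae (Filter.Eventually.of_forall fun ξ => ?_)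
    have h : ∑ i : Fin n, (ξ : Eucl n) i •
        (c u * hc v * hc w * N * c (e n i) * ∑ j : Fin n, (ξ : Eucl n) j • c (e n j))
        = -(inner ℝ (ξ : Eucl n) ξ : ℝ) • (hc v * hc w * (c u * N)) := by
      rw [sum_smul_mul_mul, sum_smul_c_e]
      rw [mul_assoc _ (c _), c_mul_c_self, mul_assoc (c u), (commute_c_hc_mul_hc u v w).eq,
        mul_smul_comm, mul_one, mul_assoc _ (c u)]
    simp only [h, map_smul, key, smul_zero, Pi.zero_apply]
  · refine integral_eq_zero_of_ae (Filter.Eventually.of_forall fun ξ => ?_)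
    have h : ∑ i : Fin n, (ξ : Eucl n) i •
        (c u * hc v * hc w * c (e n i) * N * ∑ j : Fin n, (ξ : Eucl n) j • c (e n j))
        = c u * (hc v * hc w) * c (ξ : Eucl n) * N * c (ξ : Eucl n) := by
      simp only [mul_assoc _ N]
      rw [sum_smul_mul_mul, sum_smul_c_e, mul_assoc (c u)]
    have h' : c (ξ : Eucl n) * (c u * (hc v * hc w) * c (ξ : Eucl n) * N)
        = hc v * hc w * (c (ξ : Eucl n) * c u * c (ξ : Eucl n) * N) := by
      rw [(commute_c_hc_mul_hc u v w).eq]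
      simp only [← mul_assoc]
      rw [mul_assoc (c _) (hc v), (commute_c_hc_mul_hc _ v w).eq]
    simp only [h, Pi.zero_apply]
    rw [Tr_mul_comm, h', c_mul_c_mul_c, key]
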